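/- Let p be a prime, let a ≥ 1 be an integer with gcd(a, p) = 1, let ā denote the image of a in 𝔽_p, and set Z_a := Σ_{j=1}^{p−1} j·p^{(j+1)a−1}. Then in 𝔽_p one has Tr(θ^{Z_a}) = Tr(θ^{τ_p(a)}) = ā^{τ_p(a)} · b_{τ_p(a)}(ā^{−1}), where b_{τ_p(a)}(ā^{−1}) denotes the evaluation at ā^{−1} ∈ 𝔽_p of the Bell polynomial b_{τ_p(a)}(x) reduced modulo p. -/

import Mathlib

/-- Stirling numbers of the second kind. -/
def stirling2 : ℕ → ℕ → ℕ
  | 0, 0 => 1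
  | 0, _ + 1 => 0
  | _ + 1, 0 => 0
  | n + 1, j + 1 => (j + 1) * stirling2 n (j + 1) + stirling2 n j

/-- Evaluation of the Bell polynomial `b_n(x) = ∑_j S(n,j) x^j`. -/
def bellEval {R : Type*} [CommRing R] (n : ℕ) (x : R) : R :=
  ∑ j ∈ Finset.range (n + 1), (stirling2 n j : R) * x ^ j

/-- `τ_p(a) = ∑_{j=1}^{p-1} j p^{ja-1}`. -/
def tauP (p a : ℕ) : ℕ := ∑ j ∈ Finset.Icc 1 (p - 1), j * p ^ (j * a - 1)

/-- `Z_a = ∑_{j=1}^{p-1} j p^{(j+1)a-1}`. -/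
def ZetaRep (p a : ℕ) : ℕ := ∑ j ∈ Finset.Icc 1 (p - 1), j * p ^ ((j + 1) * a - 1)

theorem stirling2_eq_zero_of_lt : ∀ {n j : ℕ}, n < j → stirling2 n j = 0
  | 0, _ + 1, _ => rfl
  | n + 1, j + 1, h => by
    simp only [stirling2, stirling2_eq_zero_of_lt (show n < j + 1 by omega),
      stirling2_eq_zero_of_lt (show n < j by omega), mul_zero, add_zero]

theorem pow_eq_sum_stirling2 {R : Type*} [CommRing R] (t : R) (n : ℕ) :
    t ^ n = ∑ j ∈ Finset.range (n + 1), (stirling2 n j : R) * ∏ i ∈ Finset.range j, (t - i) := by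
  induction n with
  | zero => simp [stirling2]
  | succ n ih =>
    have h (j : ℕ) : (stirling2 n j : R) * (∏ i ∈ Finset.range j, (t - i)) * t =
        stirling2 n j * ∏ i ∈ Finset.range (j + 1), (t - i) +
          j * stirling2 n j * ∏ i ∈ Finset.range j, (t - i) := by
      rw [Finset.prod_range_succ]; ring
    rw [pow_succ, ih, Finset.sum_mul, Finset.sum_congr rfl fun j _ => h j,
      Finset.sum_add_distrib, Finset.sum_range_succ' _ (n + 1)]
    have h0 : ∑ j ∈ Finset.range (n + 1),
          (j * stirling2 n j * ∏ i ∈ Finset.range j, (t - i) : R) =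
        ∑ j ∈ Finset.range (n + 1),
          ((j + 1 : ℕ) * stirling2 n (j + 1) * ∏ i ∈ Finset.range (j + 1), (t - i) : R) := by
      have := Finset.sum_range_succ'
        (fun j : ℕ => (j * stirling2 n j * ∏ i ∈ Finset.range j, (t - i) : R)) (n + 1)
      rw [Finset.sum_range_succ] at this
      simpa [stirling2_eq_zero_of_lt (Nat.lt_succ_self n)] using this
    rw [h0, ← Finset.sum_add_distrib]
    simp only [stirling2, Nat.cast_zero, zero_mul, add_zero]
    refine Finset.sum_congr rfl fun j _ => ?_
    push_cast
    ring

/-- A functional with `M (t y) = x M (σ y)`, where `σ t = t + 1`, is the Bell umbra. -/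
theorem map_pow_eq_bellEval {K A : Type*} [Field K] [CommRing A] [Algebra K A]
    (M : A →ₗ[K] K) (σ : A →ₐ[K] A) (t : A) (x : K) (ht : σ t = t + 1) (h1 : M 1 = 1)
    (hM : ∀ y, M (t * y) = x * M (σ y)) (n : ℕ) : M (t ^ n) = bellEval n x := by
  have key (k : ℕ) : M (∏ i ∈ Finset.range k, (t - i)) = x ^ k := by
    induction k with
    | zero => simpa using h1
    | succ k ih =>
      rw [Finset.prod_range_succ', Nat.cast_zero, sub_zero, mul_comm, hM, map_prod, pow_succ', ← ih]
      congr 2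
      refine Finset.prod_congr rfl fun i _ => ?_
      rw [map_sub, ht, map_natCast, Nat.cast_succ]
      ring
  rw [pow_eq_sum_stirling2, map_sum, bellEval]
  refine Finset.sum_congr rfl fun j _ => ?_
  rw [← nsmul_eq_mul, map_nsmul, key, nsmul_eq_mul]

theorem sum_mul_pow_add_sum_pow (p a m : ℕ) (ha : 1 ≤ a) :
    p ^ a * ∑ j ∈ Finset.Icc 1 m, j * p ^ (j * a - 1) +
        ∑ j ∈ Finset.range (m + 1), p ^ ((j + 1) * a - 1) =
      ∑ j ∈ Finset.Icc 1 m, j * p ^ (j * a - 1) + (m + 1) * p ^ ((m + 1) * a - 1) := by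
  induction m with
  | zero => simp
  | succ m ih =>
    rw [Finset.sum_Icc_succ_top (by omega), Finset.sum_range_succ]
    have h : p ^ ((m + 1 + 1) * a - 1) = p ^ a * p ^ ((m + 1) * a - 1) := by
      rw [← pow_add]
      congr 1
      have : 1 ≤ (m + 1) * a := Nat.mul_pos (by omega) ha
      rw [add_mul (m + 1) 1 a]
      omega
    rw [h]
    linear_combination ih

theorem pow_mul_tauP_add_sum_pow (p a : ℕ) (hp : 1 ≤ p) (ha : 1 ≤ a) :
    p ^ a * tauP p a + ∑ j ∈ Finset.range p, p ^ ((j + 1) * a - 1) =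
      tauP p a + p ^ (p * a) := by
  have h := sum_mul_pow_add_sum_pow p a (p - 1) ha
  rw [Nat.sub_add_cancel hp] at h
  rw [tauP, h, ← pow_succ', Nat.sub_add_cancel (Nat.mul_pos hp ha)]

theorem zetaRep_eq_tauP_mul (p a : ℕ) (ha : 1 ≤ a) : ZetaRep p a = tauP p a * p ^ a := by
  rw [ZetaRep, tauP, Finset.sum_mul]
  refine Finset.sum_congr rfl fun j hj => ?_
  have : 1 ≤ j * a := Nat.mul_pos (Finset.mem_Icc.1 hj).1 ha
  rw [mul_assoc, ← pow_add, add_mul]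
  congr 2
  omega

section ArtinSchreier

open Polynomial

variable {p : ℕ} [Fact p.Prime] {F : Type*} [Field F] [Algebra (ZMod p) F]

@[to_additive]
theorem prod_range_eq_univ_zmod {M : Type*} [CommMonoid M] {c : ZMod p} (hc : c ≠ 0)
    (f : ZMod p → M) : ∏ i ∈ Finset.range p, f (i * c) = ∏ x, f x := by
  rw [← Equiv.prod_comp (Equiv.mulRight₀ c hc)]
  refine Finset.prod_bij (fun i _ => (i : ZMod p)) (fun _ _ => Finset.mem_univ _) ?_ ?_
    fun _ _ => rfl
  · intro i hi j hj h
    have := (ZMod.natCast_eq_natCast_iff' _ _ _).1 h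
    rwa [Nat.mod_eq_of_lt (Finset.mem_range.1 hi), Nat.mod_eq_of_lt (Finset.mem_range.1 hj)] at this
  · exact fun x _ => ⟨x.val, Finset.mem_range.2 x.val_lt, ZMod.natCast_zmod_val x⟩

theorem sum_eval_zmod_eq_neg_coeff {f : F[X]} (hf : f.natDegree < p) :
    ∑ x : ZMod p, f.eval (algebraMap (ZMod p) F x) = -f.coeff (p - 1) := by
  have hp := (Fact.out : p.Prime).two_le
  simp_rw [eval_eq_sum_range' hf]
  rw [Finset.sum_comm, Finset.sum_eq_single (p - 1)]
  · simp_rw [← Finset.mul_sum, ← map_pow, ← map_sum]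
    have : ∑ x : ZMod p, x ^ (p - 1) = -1 := by
      simp_rw [ZMod.pow_card_sub_one]
      rw [Finset.sum_ite]
      simp [Finset.filter_ne', Finset.card_erase_of_mem, ZMod.card, Nat.cast_sub (by omega : 1 ≤ p)]
    rw [this]
    simp
  · intro k hk hk'
    simp_rw [← Finset.mul_sum, ← map_pow, ← map_sum]
    rw [FiniteField.sum_pow_lt_card_sub_one, map_zero, mul_zero]
    rw [ZMod.card]
    have := Finset.mem_range.1 hk
    omega
  · intro h
    exact absurd (Finset.mem_range.2 (by omega)) h

variable {θ : F} {σ : F ≃ₐ[ZMod p] F} {c : ZMod p}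

theorem pow_apply_root (hσ : σ θ = θ + algebraMap _ _ c) (n : ℕ) :
    (σ ^ n) θ = θ + algebraMap _ _ (n * c) := by
  induction n with
  | zero => simp
  | succ n ih =>
    rw [pow_succ', AlgEquiv.mul_apply, ih, map_add, hσ, AlgEquiv.commutes, add_assoc, ← map_add]
    congr 2
    push_cast
    ring

variable [Fintype F]

theorem finrank_eq_of_card (hcard : Fintype.card F = p ^ p) :
    Module.finrank (ZMod p) F = p := by
  have h := Module.card_eq_pow_finrank (K := ZMod p) (V := F)
  rw [hcard, ZMod.card] at h
  exact (Nat.pow_right_injective (Fact.out : p.Prime).two_le h).symm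

theorem algebraMap_trace_eq_sum_pow_apply (hcard : Fintype.card F = p ^ p)
    (hσ : σ θ = θ + algebraMap _ _ c) (hc : c ≠ 0) (y : F) :
    algebraMap (ZMod p) F (Algebra.trace (ZMod p) F y) = ∑ i ∈ Finset.range p, (σ ^ i) y := by
  rw [trace_eq_sum_automorphisms, Finset.sum_range]
  refine (Function.Bijective.sum_comp (e := fun i : Fin p => σ ^ (i : ℕ)) ?_ fun g => g y).symm
  rw [Fintype.bijective_iff_injective_and_card, Fintype.card_fin, ← Nat.card_eq_fintype_card,
    IsGalois.card_aut_eq_finrank, finrank_eq_of_card hcard]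
  refine ⟨fun i j h => ?_, rfl⟩
  have h' := DFunLike.congr_fun h θ
  simp only [pow_apply_root hσ] at h'
  have h'' := mul_right_cancel₀ hc ((algebraMap (ZMod p) F).injective (add_left_cancel h'))
  have := (ZMod.natCast_eq_natCast_iff' _ _ _).1 h''
  rw [Nat.mod_eq_of_lt i.2, Nat.mod_eq_of_lt j.2] at this
  exact Fin.ext this

theorem trace_mul_trace (hcard : Fintype.card F = p ^ p)
    (hσ : σ θ = θ + algebraMap _ _ c) (hc : c ≠ 0) (x y : F) :
    Algebra.trace (ZMod p) F x * Algebra.trace (ZMod p) F y =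
      ∑ i ∈ Finset.range p, Algebra.trace (ZMod p) F ((σ ^ i) x * y) := by
  rw [← smul_eq_mul, ← map_smul, Algebra.smul_def,
    algebraMap_trace_eq_sum_pow_apply hcard hσ hc, Finset.sum_mul, map_sum]

theorem trace_aeval_eq_neg_coeff (hcard : Fintype.card F = p ^ p)
    (hσ : σ θ = θ + algebraMap _ _ c) (hc : c ≠ 0)
    {f : (ZMod p)[X]} (hf : f.natDegree < p) :
    Algebra.trace (ZMod p) F (aeval θ f) = -f.coeff (p - 1) := by
  apply (algebraMap (ZMod p) F).injective
  rw [algebraMap_trace_eq_sum_pow_apply hcard hσ hc]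
  have h (i : ℕ) : (σ ^ i) (aeval θ f) =
      (taylor θ (f.map (algebraMap (ZMod p) F))).eval (algebraMap _ _ (i * c)) := by
    rw [← aeval_algHom_apply, pow_apply_root hσ, taylor_eval, eval_map_algebraMap, add_comm]
  rw [Finset.sum_congr rfl fun i _ => h i, sum_range_eq_univ_zmod hc fun x =>
    (taylor θ (f.map (algebraMap (ZMod p) F))).eval (algebraMap _ _ x),
    sum_eval_zmod_eq_neg_coeff (by simpa using hf), map_neg, ← coeff_map]
  congr 1
  have hd : (f.map (algebraMap (ZMod p) F)).natDegree < p := by simpa using hf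
  rcases eq_or_ne (f.map (algebraMap (ZMod p) F)).natDegree (p - 1) with h | h
  · rw [← h, coeff_taylor_natDegree, leadingCoeff]
  · rw [coeff_eq_zero_of_natDegree_lt, coeff_eq_zero_of_natDegree_lt]
    · omega
    · rw [natDegree_taylor]; omega

theorem trace_inv_root (hcard : Fintype.card F = p ^ p)
    (hσ : σ θ = θ + algebraMap _ _ c) (hc : c ≠ 0) (hθ : θ ^ p = θ + 1) :
    Algebra.trace (ZMod p) F θ⁻¹ = -1 := by
  have hp := (Fact.out : p.Prime).two_le
  have h : θ⁻¹ = aeval θ (X ^ (p - 1) - C 1 : (ZMod p)[X]) := by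
    apply inv_eq_of_mul_eq_one_right
    simp only [map_sub, map_pow, aeval_X, map_one]
    rw [mul_sub, ← pow_succ', Nat.sub_add_cancel (by omega), hθ]
    ring
  rw [h, trace_aeval_eq_neg_coeff hcard hσ hc (by rw [natDegree_X_pow_sub_C]; omega)]
  simp [coeff_one, show p - 1 ≠ 0 by omega]

theorem trace_mul_trace_inv (hcard : Fintype.card F = p ^ p)
    (hσ : σ θ = θ + algebraMap _ _ c) (hc : c ≠ 0) {u : F} (hu : u ≠ 0)
    (hσu : σ u = θ * u) :
    Algebra.trace (ZMod p) F u * Algebra.trace (ZMod p) F u⁻¹ = -1 := by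
  have hp := (Fact.out : p.Prime).two_le
  let f (d : ℕ) : (ZMod p)[X] := ∏ i ∈ Finset.range d, (X + C (i * c))
  have hmonic (d : ℕ) : (f d).Monic := monic_prod_of_monic _ _ fun _ _ => monic_X_add_C _
  have hdeg (d : ℕ) : (f d).natDegree = d := by
    rw [natDegree_prod_of_monic _ _ fun _ _ => monic_X_add_C _]
    simp only [natDegree_X_add_C, Finset.sum_const, Finset.card_range, smul_eq_mul, mul_one]
  have hpow (d : ℕ) : (σ ^ d) u = aeval θ (f d) * u := by
    induction d with
    | zero => simp [f]
    | succ d ih =>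
      rw [pow_succ, AlgEquiv.mul_apply, hσu, map_mul, ih, pow_apply_root hσ]
      simp only [f, Finset.prod_range_succ, map_mul, map_add, aeval_X, aeval_C]
      ring
  rw [trace_mul_trace hcard hσ hc, Finset.sum_eq_single (p - 1)]
  · rw [hpow, mul_inv_cancel_right₀ hu, trace_aeval_eq_neg_coeff hcard hσ hc (by rw [hdeg]; omega)]
    have := (hmonic (p - 1)).coeff_natDegree
    rw [hdeg] at this
    rw [this]
  · intro d hd hd'
    have := Finset.mem_range.1 hd
    rw [hpow, mul_inv_cancel_right₀ hu, trace_aeval_eq_neg_coeff hcard hσ hc (by rw [hdeg]; omega),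
      coeff_eq_zero_of_natDegree_lt (by rw [hdeg]; omega), neg_zero]
  · intro h
    exact absurd (Finset.mem_range.2 (by omega)) h

theorem trace_pow_eq_bellEval (hcard : Fintype.card F = p ^ p)
    (hσ : σ θ = θ + algebraMap _ _ c) (hc : c ≠ 0)
    (hθ : θ ^ p = θ + 1) (hθ0 : θ ≠ 0) {n : ℕ} (hσu : σ (θ ^ n) = θ * θ ^ n) :
    Algebra.trace (ZMod p) F (θ ^ n) = c ^ n * bellEval n c⁻¹ := by
  have hu : θ ^ n ≠ 0 := pow_ne_zero _ hθ0
  have hTr (y : F) : Algebra.trace (ZMod p) F (σ y) = Algebra.trace (ZMod p) F y :=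
    Algebra.trace_eq_of_algEquiv σ y
  let M : F →ₗ[ZMod p] ZMod p := -Algebra.trace (ZMod p) F (θ ^ n) •
    (Algebra.trace (ZMod p) F ∘ₗ LinearMap.mulRight (ZMod p) (σ (θ ^ n))⁻¹)
  have hMdef (y : F) : M y = -Algebra.trace (ZMod p) F (θ ^ n) *
      Algebra.trace (ZMod p) F (y * (σ (θ ^ n))⁻¹) := rfl
  have hM (y : F) : M (θ * y) = M (σ y) := by
    rw [hMdef, hMdef, ← map_inv₀, ← map_mul, hTr, map_inv₀, hσu]
    congr 2
    field_simp
  have h1 : M 1 = 1 := by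
    rw [hMdef, one_mul, ← map_inv₀, hTr, neg_mul, trace_mul_trace_inv hcard hσ hc hu hσu, neg_neg]
  have hbell := map_pow_eq_bellEval M (σ : F →ₐ[ZMod p] F) (c⁻¹ • θ) c⁻¹
    (by
      rw [AlgEquiv.coe_toAlgHom, map_smul, hσ, smul_add, Algebra.algebraMap_eq_smul_one, smul_smul,
        inv_mul_cancel₀ hc, one_smul])
    h1 (fun y => by rw [smul_mul_assoc, map_smul, hM, smul_eq_mul, AlgEquiv.coe_toAlgHom]) n
  rw [← hbell, _root_.smul_pow, map_smul, smul_eq_mul, ← mul_assoc, ← mul_pow, mul_inv_cancel₀ hc,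
    one_pow, one_mul, hMdef, hσu, mul_inv, mul_left_comm, mul_inv_cancel₀ hu, mul_one,
    trace_inv_root hcard hσ hc hθ]
  ring

end ArtinSchreier

theorem pow_pow_eq_add_natCast {R : Type*} [CommRing R] {p : ℕ} [Fact p.Prime] [CharP R p] {θ : R}
    (hθ : θ ^ p = θ + 1) (n : ℕ) : θ ^ p ^ n = θ + n := by
  induction n with
  | zero => simp
  | succ n ih =>
    have hn : (n : R) ^ p = n := by
      simpa only [frobenius_def] using map_natCast (frobenius R p) n
    rw [pow_succ, pow_mul, ih, add_pow_char, hθ, hn]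
    push_cast
    ring

open Polynomial in
theorem prod_sub_algebraMap_zmod {p : ℕ} [Fact p.Prime] {F : Type*} [Field F] [Algebra (ZMod p) F]
    (y : F) : ∏ x : ZMod p, (y - algebraMap (ZMod p) F x) = y ^ p - y := by
  have hp := (Fact.out : p.Prime).one_lt
  have hroots := FiniteField.roots_X_pow_card_sub_X (ZMod p)
  rw [ZMod.card] at hroots
  have h := prod_multiset_X_sub_C_of_monic_of_roots_card_eq (p := (X ^ p - X : (ZMod p)[X]))
    (monic_X_pow_sub (by rw [degree_X]; exact_mod_cast hp))
    (by rw [hroots, FiniteField.X_pow_card_sub_X_natDegree_eq _ hp]; simp [ZMod.card])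
  rw [hroots] at h
  change ∏ x : ZMod p, (X - C x) = _ at h
  simpa using congrArg (aeval y) h

theorem prod_add_natCast_eq_one {p : ℕ} [Fact p.Prime] {F : Type*} [Field F] [Algebra (ZMod p) F]
    {θ : F} (hθ : θ ^ p = θ + 1) {a : ℕ} (ha : 1 ≤ a) (hc : (a : ZMod p) ≠ 0) :
    ∏ j ∈ Finset.range p, (θ + ((j + 1) * a - 1 : ℕ)) = 1 := by
  have h (j : ℕ) : θ + ((j + 1) * a - 1 : ℕ) =
      θ - algebraMap (ZMod p) F (-(j * a + (a - 1))) := by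
    rw [Nat.cast_sub (Nat.mul_pos j.succ_pos ha)]
    simp only [map_neg, map_add, map_mul, map_sub, map_natCast, map_one]
    push_cast
    ring
  rw [Finset.prod_congr rfl fun j _ => h j, prod_range_eq_univ_zmod hc fun x =>
    θ - algebraMap (ZMod p) F (-(x + (a - 1))),
    show ∏ x, (θ - algebraMap (ZMod p) F (-(x + (a - 1)))) = ∏ x, (θ - algebraMap (ZMod p) F x) from
      Equiv.prod_comp ((Equiv.addRight ((a : ZMod p) - 1)).trans (Equiv.neg _))
        fun x => θ - algebraMap (ZMod p) F x, prod_sub_algebraMap_zmod, hθ, add_sub_cancel_left]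

/-- `Tr(θ^{Z_a}) = Tr(θ^{τ_p(a)}) = a^{τ_p(a)} b_{τ_p(a)}(a⁻¹)` in `𝔽_p`. -/
theorem trace_zeta_eq_trace_tau_eq_bell
    (p : ℕ) [Fact p.Prime]
    (F : Type*) [Field F] [Fintype F] [Algebra (ZMod p) F]
    (hcard : Fintype.card F = p ^ p)
    (θ : F) (hθ : θ ^ p = θ + 1)
    (a : ℕ) (ha : 1 ≤ a) (hap : Nat.gcd a p = 1) :
    Algebra.trace (ZMod p) F (θ ^ ZetaRep p a) =
        Algebra.trace (ZMod p) F (θ ^ tauP p a) ∧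
      Algebra.trace (ZMod p) F (θ ^ tauP p a) =
        (a : ZMod p) ^ tauP p a * bellEval (tauP p a) ((a : ZMod p)⁻¹) := by
  have hp := (Fact.out : p.Prime).two_le
  have : CharP F p := charP_of_injective_algebraMap (algebraMap (ZMod p) F).injective p
  have hc : (a : ZMod p) ≠ 0 := by
    rw [Ne, ZMod.natCast_eq_zero_iff]
    intro h
    have := Nat.dvd_gcd h dvd_rfl
    rw [hap, Nat.dvd_one] at this
    omega
  have hθ0 : θ ≠ 0 := by
    rintro rfl
    simp [zero_pow (by omega : p ≠ 0)] at hθ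
  let σ : F ≃ₐ[ZMod p] F := FiniteField.frobeniusAlgEquivOfAlgebraic (ZMod p) F ^ a
  have hσ (y : F) : σ y = y ^ p ^ a := by
    rw [AlgEquiv.coe_pow, FiniteField.coe_frobeniusAlgEquivOfAlgebraic_iterate, ZMod.card]
  constructor
  · rw [zetaRep_eq_tauP_mul p a ha, pow_mul, ← hσ]
    exact Algebra.trace_eq_of_algEquiv σ (θ ^ tauP p a)
  · refine trace_pow_eq_bellEval hcard (σ := σ) ?_ hc hθ hθ0 ?_
    · rw [hσ, pow_pow_eq_add_natCast hθ, map_natCast]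
    · have h1 : ∏ j ∈ Finset.range p, θ ^ p ^ ((j + 1) * a - 1) = 1 := by
        simp_rw [pow_pow_eq_add_natCast hθ]
        exact prod_add_natCast_eq_one hθ ha hc
      have h2 := congrArg (θ ^ ·) (pow_mul_tauP_add_sum_pow p a (by omega) ha)
      simp only [pow_add, ← Finset.prod_pow_eq_pow_sum, h1, mul_one] at h2
      rw [hσ, ← pow_mul, mul_comm, h2, pow_mul p p a, ← hcard, FiniteField.pow_card_pow, mul_comm]
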